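/- Let ι be a finite type, S : ι → Type a family of state spaces, prec a relation on ι whose transitive closure is irreflexive (a DAG), and u a family of update functions that is local with respect to prec. Then for any initial global state x₀ and any two topological sorts ℓ₁ and ℓ₂ of prec, the full passes along ℓ₁ and ℓ₂ coincide: List.foldl (fun x i => step i x) x₀ ℓ₁ = List.foldl (fun x i => step i x) x₀ ℓ₂. Hence the result of an update pass is independent of the choice of topological sort. -/

import Mathlib

/-- A family of update functions is local w.r.t. `prec`: the update of node `i`
depends only on the components `x j` with `prec j i`. -/
def IsLocal {ι : Type*} {S : ι → Type*} (prec : ι → ι → Prop)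
    (u : ∀ i, (∀ j, S j) → S i) : Prop :=
  ∀ i (x y : ∀ j, S j), (∀ j, prec j i → x j = y j) → u i x = u i y

/-- The step function of node `i`: replace the `i`-th component of the global
state by `u i x`, leaving all other components unchanged. -/
def step {ι : Type*} [DecidableEq ι] {S : ι → Type*}
    (u : ∀ i, (∀ j, S j) → S i) (i : ι) (x : ∀ j, S j) : ∀ j, S j :=
  Function.update x i (u i x)

/-- A list `ℓ` is a topological sort of `prec`: it contains every element of
`ι` exactly once, and whenever the transitive closure of `prec` relates `a` to
`b`, `a` occurs before `b` in `ℓ`. -/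
def IsTopoSort {ι : Type*} [Fintype ι] [DecidableEq ι]
    (prec : ι → ι → Prop) (ℓ : List ι) : Prop :=
  (∀ i : ι, ℓ.count i = 1) ∧
  ∀ a b : ι, Relation.TransGen prec a b → [a, b].Sublist ℓ

/-- Two elements of a duplicate-free list cannot occur in both orders. -/
theorem List.Nodup.not_pair_sublist_swap {α : Type*} {l : List α} (hl : l.Nodup) {a b : α}
    (hab : [a, b].Sublist l) : ¬ [b, a].Sublist l := by
  induction l with
  | nil => simp at hab
  | cons c l ih =>
    intro hba
    obtain ⟨hc, hl⟩ := List.nodup_cons.mp hl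
    have mem_of_sublist {x y : α} (h : [x, y].Sublist l) : x ∈ l ∧ y ∈ l :=
      ⟨h.subset (by simp), h.subset (by simp)⟩
    rcases List.sublist_cons_iff.mp hab with hab | ⟨r, hr, hrl⟩ <;>
      rcases List.sublist_cons_iff.mp hba with hba | ⟨r', hr', hrl'⟩
    · exact ih hl hab hba
    · grind
    · grind
    · grind

/-- Updating along a list leaves the components outside the list unchanged. -/
theorem foldl_step_apply_of_notMem {ι : Type*} [DecidableEq ι] {S : ι → Type*}
    (u : ∀ i, (∀ j, S j) → S i) {ℓ : List ι} {i : ι} (hi : i ∉ ℓ) (x : ∀ j, S j) :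
    List.foldl (fun x i => step u i x) x ℓ i = x i := by
  induction ℓ generalizing x with
  | nil => rfl
  | cons a ℓ ih =>
    obtain ⟨hia, hiℓ⟩ : i ≠ a ∧ i ∉ ℓ := by simpa using hi
    rw [List.foldl_cons, ih hiℓ, step, Function.update_of_ne hia]

/-- If no node depends on itself or on a later node of a duplicate-free list, then the result of
updating along the list is a fixed point of the update functions of the nodes in the list. -/
theorem IsLocal.foldl_step_apply {ι : Type*} [DecidableEq ι] {S : ι → Type*}
    {prec : ι → ι → Prop} {u : ∀ i, (∀ j, S j) → S i} (hloc : IsLocal prec u)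
    (hirr : ∀ i, ¬ prec i i) {ℓ : List ι} (hnd : ℓ.Nodup)
    (hℓ : ℓ.Pairwise fun a b => ¬ prec b a) (x : ∀ j, S j) {i : ι} (hi : i ∈ ℓ) :
    List.foldl (fun x i => step u i x) x ℓ i =
      u i (List.foldl (fun x i => step u i x) x ℓ) := by
  induction ℓ generalizing x with
  | nil => simp at hi
  | cons a ℓ ih =>
    obtain ⟨ha, hnd⟩ := List.nodup_cons.mp hnd
    obtain ⟨hprec, hℓ⟩ := List.pairwise_cons.mp hℓ
    rw [List.foldl_cons]
    rcases List.mem_cons.mp hi with rfl | hi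
    · rw [foldl_step_apply_of_notMem u ha, step, Function.update_self]
      refine hloc i _ _ fun j hj => ?_
      have hji : j ≠ i := fun h => hirr i (h ▸ hj)
      rw [foldl_step_apply_of_notMem u fun h => hprec j h hj, Function.update_of_ne hji]
    · exact ih hnd hℓ _ hi

/-- A full pass along a topological sort yields a fixed point of all update functions. -/
theorem IsTopoSort.foldl_step_apply {ι : Type*} [Fintype ι] [DecidableEq ι] {S : ι → Type*}
    {prec : ι → ι → Prop} {u : ∀ i, (∀ j, S j) → S i} (hloc : IsLocal prec u)
    (hirr : ∀ i, ¬ prec i i) {ℓ : List ι} (hℓ : IsTopoSort prec ℓ) (x : ∀ j, S j) (i : ι) :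
    List.foldl (fun x i => step u i x) x ℓ i =
      u i (List.foldl (fun x i => step u i x) x ℓ) := by
  have hnd : ℓ.Nodup := List.nodup_iff_count_le_one.mpr fun i => (hℓ.1 i).le
  have hi : i ∈ ℓ := List.count_pos_iff.mp (by simp [hℓ.1 i])
  refine hloc.foldl_step_apply hirr hnd (List.pairwise_iff_forall_sublist.mpr ?_) x hi
  exact fun hab hba => hnd.not_pair_sublist_swap hab (hℓ.2 _ _ (.single hba))

/-- For a well-founded dependency relation, local update functions have at most one common
fixed point. -/
theorem IsLocal.fixedPoint_unique {ι : Type*} {S : ι → Type*} {prec : ι → ι → Prop}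
    (hwf : WellFounded prec) {u : ∀ i, (∀ j, S j) → S i} (hloc : IsLocal prec u)
    {x y : ∀ j, S j} (hx : ∀ i, x i = u i x) (hy : ∀ i, y i = u i y) : x = y := by
  funext i
  induction i using hwf.induction with
  | _ i ih => rw [hx, hy, hloc i x y ih]

/-- The full pass is independent of the choice of topological sort. -/
theorem pass_independent_of_topoSort {ι : Type*} [Fintype ι] [DecidableEq ι]
    {S : ι → Type*} (prec : ι → ι → Prop)
    (hdag : Irreflexive (Relation.TransGen prec))
    (u : ∀ i, (∀ j, S j) → S i) (hloc : IsLocal prec u)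
    (x₀ : ∀ j, S j) (ℓ₁ ℓ₂ : List ι)
    (h₁ : IsTopoSort prec ℓ₁) (h₂ : IsTopoSort prec ℓ₂) :
    List.foldl (fun x i => step u i x) x₀ ℓ₁ =
      List.foldl (fun x i => step u i x) x₀ ℓ₂ := by
  have hirr (i : ι) : ¬ prec i i := fun h => hdag i (.single h)
  have hwf : WellFounded prec := by
    have : Std.Irrefl (Relation.TransGen prec) := ⟨hdag⟩
    exact Subrelation.wf Relation.TransGen.single
      (Finite.wellFounded_of_trans_of_irrefl (Relation.TransGen prec))
  exact hloc.fixedPoint_unique hwf (h₁.foldl_step_apply hloc hirr x₀)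
    (h₂.foldl_step_apply hloc hirr x₀)
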